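/- arXiv:1304.4409 — 13 statements merged into one kernel-verified Lean document; each statement's English description precedes it below -/
import Mathlib

section
/- Let C : ℝ → (Fin 4 → ℝ) be differentiable, let U be an open subset of Fin 4 → ℝ, let τ be a retarded-time map for C on U, let x ∈ U, and assume τ is differentiable at x and g X V ≠ 0, where X = x - C (τ x) and V = deriv C (τ x). Then for every v : Fin 4 → ℝ, fderiv ℝ τ x v = g X v / g X V (i.e. dτ_r = X̃ / g(X,V)). -/
/-- The Minkowski bilinear form on `ℝ⁴ = Fin 4 → ℝ`. -/
noncomputable def g (u v : Fin 4 → ℝ) : ℝ :=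
  -(u 0 * v 0) + u 1 * v 1 + u 2 * v 2 + u 3 * v 3

/-- The derivative of `t ↦ g (W t) (W t)` along a differentiable curve. -/
theorem HasDerivAt.g_self {W : ℝ → (Fin 4 → ℝ)} {W' : Fin 4 → ℝ} {t : ℝ}
    (h : HasDerivAt W W' t) :
    HasDerivAt (fun s => g (W s) (W s)) (2 * g (W t) W') t := by
  have hc := hasDerivAt_pi.1 h
  have hsq := fun i => (hc i).mul (hc i)
  refine ((((hsq 0).neg.add (hsq 1)).add (hsq 2)).add (hsq 3)).congr_deriv ?_
  simp only [g]
  ring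

theorem g_sub_smul_right (X v V : Fin 4 → ℝ) (a : ℝ) :
    g X (v - a • V) = g X v - a * g X V := by
  simp only [g, Pi.sub_apply, Pi.smul_apply, smul_eq_mul]
  ring

theorem stmt1 (C : ℝ → (Fin 4 → ℝ)) (hC : Differentiable ℝ C)
    (U : Set (Fin 4 → ℝ)) (hU : IsOpen U)
    (τ : (Fin 4 → ℝ) → ℝ)
    (hτ : ∀ y ∈ U, g (y - C (τ y)) (y - C (τ y)) = 0)
    (x : Fin 4 → ℝ) (hx : x ∈ U)
    (hdiff : DifferentiableAt ℝ τ x)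
    (X V : Fin 4 → ℝ)
    (hX : X = x - C (τ x)) (hV : V = deriv C (τ x))
    (hne : g X V ≠ 0) :
    ∀ v : Fin 4 → ℝ, fderiv ℝ τ x v = g X v / g X V := by
  intro v
  have hline : HasDerivAt (fun t : ℝ => x + t • v) v 0 := by
    simpa using ((hasDerivAt_id (0 : ℝ)).smul_const v).const_add x
  have hx0 : x + (0 : ℝ) • v = x := by simp
  have hτline : HasDerivAt (fun t : ℝ => τ (x + t • v)) (fderiv ℝ τ x v) 0 :=
    HasFDerivAt.comp_hasDerivAt (0 : ℝ) (by rw [hx0]; exact hdiff.hasFDerivAt) hline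
  have hCline : HasDerivAt (fun t : ℝ => C (τ (x + t • v))) (fderiv ℝ τ x v • V) 0 :=
    HasDerivAt.scomp (0 : ℝ) (by rw [hx0, hV]; exact (hC (τ x)).hasDerivAt) hτline
  have hg := (hline.sub hCline).g_self
  have hnear : ∀ᶠ t in nhds (0 : ℝ), x + t • v ∈ U :=
    hline.continuousAt.eventually_mem (by rw [hx0]; exact hU.mem_nhds hx)
  have hzero := hg.unique ((hasDerivAt_const (0 : ℝ) (0 : ℝ)).congr_of_eventuallyEq
    (hnear.mono fun t ht => hτ _ ht))
  simp only [Pi.sub_apply, hx0, ← hX, g_sub_smul_right] at hzero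
  rw [eq_div_iff hne]
  linarith
end

section
/- Let c > 0, let C : ℝ → (Fin 4 → ℝ) be twice differentiable with g (deriv C s) (deriv C s) = -c^2 for all s, let τ be a retarded-time map for C on an open set U, let x ∈ U with τ differentiable at x and g X V ≠ 0, where X = x - C (τ x), V = deriv C (τ x), A = deriv (deriv C) (τ x). Then the function y ↦ g (y - C (τ y)) (deriv C (τ y)) is differentiable at x and its Fréchet derivative at x sends v to g V v + ((g X A + c^2) / g X V) * g X v. -/
theorem differentiableAt_and_fderiv_g {E : Type*} [NormedAddCommGroup E] [NormedSpace ℝ E]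
    {u w : E → Fin 4 → ℝ} {u' w' : E →L[ℝ] Fin 4 → ℝ} {x : E}
    (hu : HasFDerivAt u u' x) (hw : HasFDerivAt w w' x) :
    DifferentiableAt ℝ (fun y => g (u y) (w y)) x ∧
    ∀ v : E, fderiv ℝ (fun y => g (u y) (w y)) x v = g (u' v) (w x) + g (u x) (w' v) := by
  have hu_coord := hasFDerivAt_pi'.1 hu
  have hw_coord := hasFDerivAt_pi'.1 hw
  have h := ((((hu_coord 0).mul (hw_coord 0)).neg.add ((hu_coord 1).mul (hw_coord 1))).add
    ((hu_coord 2).mul (hw_coord 2))).add ((hu_coord 3).mul (hw_coord 3))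
  refine ⟨h.differentiableAt, fun v => ?_⟩
  refine (congrArg (fun L : E →L[ℝ] ℝ => L v) h.fderiv).trans ?_
  simp [g]
  ring

theorem stmt2 (c : ℝ) (hc : 0 < c)
    (C : ℝ → (Fin 4 → ℝ))
    (hC1 : Differentiable ℝ C) (hC2 : Differentiable ℝ (deriv C))
    (hnorm : ∀ s : ℝ, g (deriv C s) (deriv C s) = -c ^ 2)
    (U : Set (Fin 4 → ℝ)) (hU : IsOpen U)
    (τ : (Fin 4 → ℝ) → ℝ)
    (hτ : ∀ y ∈ U, g (y - C (τ y)) (y - C (τ y)) = 0)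
    (x : Fin 4 → ℝ) (hx : x ∈ U)
    (hdiff : DifferentiableAt ℝ τ x)
    (X V A : Fin 4 → ℝ)
    (hX : X = x - C (τ x)) (hV : V = deriv C (τ x))
    (hA : A = deriv (deriv C) (τ x))
    (hne : g X V ≠ 0) :
    DifferentiableAt ℝ (fun y => g (y - C (τ y)) (deriv C (τ y))) x ∧
    ∀ v : Fin 4 → ℝ,
      fderiv ℝ (fun y => g (y - C (τ y)) (deriv C (τ y))) x v
        = g V v + ((g X A + c ^ 2) / g X V) * g X v := by
  have hCτ : HasFDerivAt (fun y => C (τ y)) ((fderiv ℝ τ x).smulRight V) x :=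
    ((hC1 (τ x)).hasFDerivAt.comp x hdiff.hasFDerivAt).congr_fderiv
      (by ext w; simp [hV, fderiv_eq_smul_deriv])
  have hVτ : HasFDerivAt (fun y => deriv C (τ y)) ((fderiv ℝ τ x).smulRight A) x :=
    ((hC2 (τ x)).hasFDerivAt.comp x hdiff.hasFDerivAt).congr_fderiv
      (by ext w; simp [hA, fderiv_eq_smul_deriv])
  have hXτ := (hasFDerivAt_id (𝕜 := ℝ) x).sub hCτ
  obtain ⟨hd, hf⟩ := differentiableAt_and_fderiv_g hXτ hVτ
  refine ⟨hd, fun v => (hf v).trans ?_⟩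
  have hzero : fderiv ℝ (fun y => g (y - C (τ y)) (y - C (τ y))) x v = 0 := by
    have he : (fun y => g (y - C (τ y)) (y - C (τ y))) =ᶠ[nhds x] fun _ => (0 : ℝ) :=
      Filter.eventually_of_mem (hU.mem_nhds hx) hτ
    rw [he.fderiv_eq]
    simp
  have hnull := ((differentiableAt_and_fderiv_g hXτ hXτ).2 v).symm.trans hzero
  have hVV : g V V = -c ^ 2 := hV ▸ hnorm (τ x)
  have hτv : fderiv ℝ τ x v = g X v / g X V := by
    rw [eq_div_iff hne]
    simp only [Pi.sub_apply, id_eq, hX, sub_apply,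
      ContinuousLinearMap.id_apply, ContinuousLinearMap.smulRight_apply, g, Pi.smul_apply,
      smul_eq_mul] at hnull ⊢
    linarith
  have hexpand : ∀ t : ℝ, g (v - t • V) V + g X (t • A) = g V v + t * (g X A - g V V) := by
    intro t
    simp only [g, Pi.sub_apply, Pi.smul_apply, smul_eq_mul]
    ring
  simp only [Pi.sub_apply, id_eq, ← hX, ← hV, sub_apply,
    ContinuousLinearMap.id_apply, ContinuousLinearMap.smulRight_apply]
  rw [hexpand, hτv, hVV]
  ring
end

section
/- Let c > 0, let C : ℝ → (Fin 4 → ℝ) be three times differentiable with g (deriv C s) (deriv C s) = -c^2 for all s, let τ be a retarded-time map for C on an open set U, let x ∈ U with τ differentiable at x and g X V ≠ 0, where X = x - C (τ x), V = deriv C (τ x), A = deriv (deriv C) (τ x), and Ȧ = deriv (deriv (deriv C)) (τ x). Then the function y ↦ g (y - C (τ y)) (deriv (deriv C) (τ y)) is differentiable at x and its Fréchet derivative at x sends v to g A v + (g X Ȧ / g X V) * g X v. -/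
theorem g_comm (u v : Fin 4 → ℝ) : g u v = g v u := by
  simp only [g]; ring

theorem g_sub_left (u v w : Fin 4 → ℝ) : g (u - v) w = g u w - g v w := by
  simp only [g, Pi.sub_apply]; ring

theorem g_smul_left (a : ℝ) (u v : Fin 4 → ℝ) : g (a • u) v = a * g u v := by
  simp only [g, Pi.smul_apply, smul_eq_mul]; ring

/-- The product rule for the Minkowski form. -/
theorem exists_hasFDerivAt_g {E : Type*} [NormedAddCommGroup E] [NormedSpace ℝ E]
    {P Q : E → Fin 4 → ℝ} {P' Q' : E →L[ℝ] Fin 4 → ℝ} {x : E}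
    (hP : HasFDerivAt P P' x) (hQ : HasFDerivAt Q Q' x) :
    ∃ L : E →L[ℝ] ℝ, HasFDerivAt (fun y => g (P y) (Q y)) L x ∧
      ∀ v, L v = g (P' v) (Q x) + g (P x) (Q' v) := by
  have hp := hasFDerivAt_pi'.1 hP
  have hq := hasFDerivAt_pi'.1 hQ
  refine ⟨_, ((((hp 0).mul (hq 0)).neg.add ((hp 1).mul (hq 1))).add
    ((hp 2).mul (hq 2))).add ((hp 3).mul (hq 3)), fun v => ?_⟩
  simp [g]
  ring

/-- A curve of constant Minkowski square is orthogonal to its derivative. -/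
theorem g_deriv_eq_zero_of_const {W : ℝ → Fin 4 → ℝ} {k t : ℝ}
    (hW : DifferentiableAt ℝ W t) (hk : ∀ s, g (W s) (W s) = k) :
    g (W t) (deriv W t) = 0 := by
  obtain ⟨L, hL, hLv⟩ := exists_hasFDerivAt_g hW.hasFDerivAt hW.hasFDerivAt
  simp only [hk] at hL
  have h := hLv 1
  rw [hL.unique (hasFDerivAt_const k t), fderiv_apply_one_eq_deriv,
    g_comm (deriv W t)] at h
  simp only [zero_apply] at h
  linarith

theorem stmt3 (c : ℝ) (hc : 0 < c)
    (C : ℝ → (Fin 4 → ℝ))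
    (hC1 : Differentiable ℝ C) (hC2 : Differentiable ℝ (deriv C))
    (hC3 : Differentiable ℝ (deriv (deriv C)))
    (hnorm : ∀ s : ℝ, g (deriv C s) (deriv C s) = -c ^ 2)
    (U : Set (Fin 4 → ℝ)) (hU : IsOpen U)
    (τ : (Fin 4 → ℝ) → ℝ)
    (hτ : ∀ y ∈ U, g (y - C (τ y)) (y - C (τ y)) = 0)
    (x : Fin 4 → ℝ) (hx : x ∈ U)
    (hdiff : DifferentiableAt ℝ τ x)
    (X V A Adot : Fin 4 → ℝ)
    (hX : X = x - C (τ x)) (hV : V = deriv C (τ x))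
    (hA : A = deriv (deriv C) (τ x))
    (hAdot : Adot = deriv (deriv (deriv C)) (τ x))
    (hne : g X V ≠ 0) :
    DifferentiableAt ℝ (fun y => g (y - C (τ y)) (deriv (deriv C) (τ y))) x ∧
    ∀ v : Fin 4 → ℝ,
      fderiv ℝ (fun y => g (y - C (τ y)) (deriv (deriv C) (τ y))) x v
        = g A v + (g X Adot / g X V) * g X v := by
  have hT := hdiff.hasFDerivAt
  have hCτ := (hC1 (τ x)).hasFDerivAt.comp x hT
  have hAτ := (hC3 (τ x)).hasFDerivAt.comp x hT
  have hXd := (hasFDerivAt_id (𝕜 := ℝ) x).sub hCτ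
  obtain ⟨L, hL, hLv⟩ := exists_hasFDerivAt_g hXd hXd
  obtain ⟨M, hM, hMv⟩ := exists_hasFDerivAt_g hXd hAτ
  have hL0 : L = 0 := by
    refine hL.unique ((hasFDerivAt_const (0 : ℝ) x).congr_of_eventuallyEq ?_)
    filter_upwards [hU.mem_nhds hx] with y hy
    exact hτ y hy
  have hVA : g V A = 0 := by
    rw [hV, hA]
    exact g_deriv_eq_zero_of_const (hC2 (τ x)) hnorm
  refine ⟨hM.differentiableAt, fun v => ?_⟩
  have hv := hLv v
  have hmv := hMv v
  simp only [hL0, zero_apply, sub_apply,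
    ContinuousLinearMap.id_apply, ContinuousLinearMap.comp_apply, fderiv_eq_smul_deriv,
    Pi.sub_apply,
    Function.comp_apply, id, ← hX, ← hV, ← hA, ← hAdot] at hv hmv
  rw [g_comm X, g_sub_left, g_smul_left, g_comm v X, g_comm V X] at hv
  rw [g_sub_left, g_smul_left, hVA, g_comm X (_ • _), g_smul_left, g_comm v A,
    g_comm Adot X] at hmv
  have hτv : fderiv ℝ τ x v = g X v / g X V := by
    rw [eq_div_iff hne]
    linarith
  refine (congrArg (fun F : (Fin 4 → ℝ) →L[ℝ] ℝ => F v) hM.fderiv).trans ?_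
  rw [hmv, hτv]
  ring
end

section
/- Let C : ℝ → (Fin 4 → ℝ) be three times differentiable, let τ be a retarded-time map for C on an open set U, let x ∈ U with τ differentiable at x and g X V ≠ 0, where X = x - C (τ x), V = deriv C (τ x), A = deriv (deriv C) (τ x), Ȧ = deriv (deriv (deriv C)) (τ x). Then the function y ↦ g (deriv (deriv C) (τ y)) (deriv (deriv C) (τ y)) is differentiable at x and its Fréchet derivative at x sends v to 2 * g A Ȧ * g X v / g X V (i.e. d g(A,A) = 2 g(A,Ȧ) dτ_r). -/
/-- The quadratic form `u ↦ g u u` along a differentiable map is differentiable, with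
derivative `v ↦ 2 g(F, dF v)`. -/
theorem exists_hasFDerivAt_g_self {E : Type*} [NormedAddCommGroup E] [NormedSpace ℝ E]
    {F : E → (Fin 4 → ℝ)} {F' : E →L[ℝ] (Fin 4 → ℝ)} {x : E} (hF : HasFDerivAt F F' x) :
    ∃ L : E →L[ℝ] ℝ, HasFDerivAt (fun y => g (F y) (F y)) L x ∧
      ∀ v, L v = 2 * g (F x) (F' v) := by
  have h := hasFDerivAt_pi'.1 hF
  refine ⟨_, ((((h 0).mul (h 0)).neg.add ((h 1).mul (h 1))).add
    ((h 2).mul (h 2))).add ((h 3).mul (h 3)), fun v => ?_⟩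
  simp [g]
  ring

/-- The differential of a retarded-time map satisfies `g(X, V) dτ = g(X, ·)`. -/
theorem g_mul_retardedTime_deriv {C : ℝ → (Fin 4 → ℝ)} {τ : (Fin 4 → ℝ) → ℝ}
    {x V : Fin 4 → ℝ} {τ' : (Fin 4 → ℝ) →L[ℝ] ℝ} (hC : HasDerivAt C V (τ x))
    (hτ' : HasFDerivAt τ τ' x)
    (hτ : ∀ᶠ y in nhds x, g (y - C (τ y)) (y - C (τ y)) = 0) (v : Fin 4 → ℝ) :
    g (x - C (τ x)) V * τ' v = g (x - C (τ x)) v := by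
  obtain ⟨L, hL, hLv⟩ := exists_hasFDerivAt_g_self
    ((hasFDerivAt_id x).fun_sub (hC.hasFDerivAt.comp x hτ'))
  have hL0 : L = 0 := hL.unique ((hasFDerivAt_const (0 : ℝ) x).congr_of_eventuallyEq hτ)
  have h := hLv v
  simp [hL0, g] at h
  simp only [g, Pi.sub_apply]
  linarith

theorem stmt4 (C : ℝ → (Fin 4 → ℝ))
    (hC1 : Differentiable ℝ C) (hC2 : Differentiable ℝ (deriv C))
    (hC3 : Differentiable ℝ (deriv (deriv C)))
    (U : Set (Fin 4 → ℝ)) (hU : IsOpen U)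
    (τ : (Fin 4 → ℝ) → ℝ)
    (hτ : ∀ y ∈ U, g (y - C (τ y)) (y - C (τ y)) = 0)
    (x : Fin 4 → ℝ) (hx : x ∈ U)
    (hdiff : DifferentiableAt ℝ τ x)
    (X V A Adot : Fin 4 → ℝ)
    (hX : X = x - C (τ x)) (hV : V = deriv C (τ x))
    (hA : A = deriv (deriv C) (τ x))
    (hAdot : Adot = deriv (deriv (deriv C)) (τ x))
    (hne : g X V ≠ 0) :
    DifferentiableAt ℝ
      (fun y => g (deriv (deriv C) (τ y)) (deriv (deriv C) (τ y))) x ∧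
    ∀ v : Fin 4 → ℝ,
      fderiv ℝ (fun y => g (deriv (deriv C) (τ y)) (deriv (deriv C) (τ y))) x v
        = 2 * g A Adot * g X v / g X V := by
  subst hX hV hA hAdot
  obtain ⟨L, hL, hLv⟩ := exists_hasFDerivAt_g_self
    ((hC3 (τ x)).hasDerivAt.hasFDerivAt.comp x hdiff.hasFDerivAt)
  refine ⟨hL.differentiableAt, fun v => ?_⟩
  have h := g_mul_retardedTime_deriv (hC1 (τ x)).hasDerivAt hdiff.hasFDerivAt
    (Filter.eventually_of_mem (hU.mem_nhds hx) hτ) v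
  have hd : fderiv ℝ (fun y => g (deriv (deriv C) (τ y)) (deriv (deriv C) (τ y))) x = L :=
    hL.fderiv
  rw [hd, hLv, eq_div_iff hne, ← h]
  simp [g]
  ring
end

section
/- Let c > 0, let C : ℝ → (Fin 4 → ℝ) be twice differentiable with g (deriv C s) (deriv C s) = -c^2 for all s, let τ be a retarded-time map for C on an open set U, and let x ∈ U with τ differentiable at x and g X V ≠ 0, where X = x - C (τ x), V = deriv C (τ x), A = deriv (deriv C) (τ x). For w : Fin 4 → ℝ define the scalar Liénard–Wiechert potential component A_w : U → ℝ by A_w y = g (deriv C (τ y)) w / g (y - C (τ y)) (deriv C (τ y)). Then for all u, w : Fin 4 → ℝ, each A_w is differentiable at x and the antisymmetrized derivative (the Liénard–Wiechert field 2-form) satisfies: fderiv ℝ A_w x u - fderiv ℝ A_u x w = (g X V * (g X u * g A w - g X w * g A u) - (g X A + c^2) * (g X u * g V w - g X w * g V u)) / (g X V)^3. -/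
theorem g_zero_right (u : Fin 4 → ℝ) : g u 0 = 0 := by
  simp [g]

/-- The product rule for the Minkowski form. -/
theorem HasFDerivAt.exists_g {E : Type*} [NormedAddCommGroup E] [NormedSpace ℝ E]
    {f h : E → (Fin 4 → ℝ)} {f' h' : E →L[ℝ] (Fin 4 → ℝ)} {x : E}
    (hf : HasFDerivAt f f' x) (hh : HasFDerivAt h h' x) :
    ∃ L : E →L[ℝ] ℝ, HasFDerivAt (fun y => g (f y) (h y)) L x ∧
      ∀ u, L u = g (f' u) (h x) + g (f x) (h' u) := by
  have hm (i : Fin 4) := (hasFDerivAt_pi'.1 hf i).mul (hasFDerivAt_pi'.1 hh i)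
  refine ⟨_, (((hm 0).neg.add (hm 1)).add (hm 2)).add (hm 3), fun u => ?_⟩
  simp [g]
  ring

/-- The chain rule for a curve reparametrized by a scalar function. -/
theorem exists_hasFDerivAt_curve_comp {E F : Type*} [NormedAddCommGroup E] [NormedSpace ℝ E]
    [NormedAddCommGroup F] [NormedSpace ℝ F] {γ : ℝ → F} {τ : E → ℝ} {x : E}
    (hγ : DifferentiableAt ℝ γ (τ x)) (hτ : DifferentiableAt ℝ τ x) :
    ∃ L : E →L[ℝ] F, HasFDerivAt (fun y => γ (τ y)) L x ∧
      ∀ u, L u = fderiv ℝ τ x u • deriv γ (τ x) :=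
  ⟨_, hγ.hasDerivAt.hasFDerivAt.comp x hτ.hasFDerivAt, fun u => by simp⟩

/-- The derivative of a retarded-time map is `u ↦ g X u / g X V`. -/
theorem fderiv_retardedTime {C : ℝ → (Fin 4 → ℝ)} {τ : (Fin 4 → ℝ) → ℝ} {x : Fin 4 → ℝ}
    (hC : DifferentiableAt ℝ C (τ x)) (hτ : DifferentiableAt ℝ τ x)
    (hnull : ∀ᶠ y in nhds x, g (y - C (τ y)) (y - C (τ y)) = 0)
    (hne : g (x - C (τ x)) (deriv C (τ x)) ≠ 0) (u : Fin 4 → ℝ) :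
    fderiv ℝ τ x u = g (x - C (τ x)) u / g (x - C (τ x)) (deriv C (τ x)) := by
  obtain ⟨K, hK, hKu⟩ := exists_hasFDerivAt_curve_comp hC hτ
  have hd := (hasFDerivAt_id x).fun_sub hK
  obtain ⟨L, hL, hLu⟩ := hd.exists_g hd
  have hL0 : L = 0 := hL.unique ((hasFDerivAt_const (0 : ℝ) x).congr_of_eventuallyEq hnull)
  have h := hLu u
  simp only [hL0, zero_apply, sub_apply,
    ContinuousLinearMap.id_apply, id_eq, hKu] at h
  rw [g_comm (x - C (τ x)) (u - _), g_sub_left, g_smul_left, g_comm u,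
    g_comm (deriv C (τ x))] at h
  rw [eq_div_iff hne]
  linarith

/-- The derivative of a component of the Liénard–Wiechert potential, in terms of that of `τ`. -/
theorem hasFDerivAt_lienardWiechert {C : ℝ → (Fin 4 → ℝ)} {τ : (Fin 4 → ℝ) → ℝ}
    {x : Fin 4 → ℝ} (hC : DifferentiableAt ℝ C (τ x))
    (hC' : DifferentiableAt ℝ (deriv C) (τ x)) (hτ : DifferentiableAt ℝ τ x)
    (hne : g (x - C (τ x)) (deriv C (τ x)) ≠ 0) (w : Fin 4 → ℝ) :
    ∃ L : (Fin 4 → ℝ) →L[ℝ] ℝ,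
      HasFDerivAt (fun y => g (deriv C (τ y)) w / g (y - C (τ y)) (deriv C (τ y))) L x ∧
      ∀ u, L u =
        (fderiv ℝ τ x u * g (deriv (deriv C) (τ x)) w * g (x - C (τ x)) (deriv C (τ x))
          - g (deriv C (τ x)) w * (g (deriv C (τ x)) u
            - fderiv ℝ τ x u * g (deriv C (τ x)) (deriv C (τ x))
            + fderiv ℝ τ x u * g (x - C (τ x)) (deriv (deriv C) (τ x))))
        / g (x - C (τ x)) (deriv C (τ x)) ^ 2 := by
  obtain ⟨K, hK, hKu⟩ := exists_hasFDerivAt_curve_comp hC hτ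
  obtain ⟨K', hK', hKu'⟩ := exists_hasFDerivAt_curve_comp hC' hτ
  obtain ⟨N, hN, hNu⟩ := hK'.exists_g (hasFDerivAt_const w x)
  obtain ⟨R, hR, hRu⟩ := ((hasFDerivAt_id x).fun_sub hK).exists_g hK'
  refine ⟨_, hN.mul ((hasDerivAt_inv hne).comp_hasFDerivAt x hR), fun u => ?_⟩
  simp only [add_apply, smul_apply, smul_eq_mul,
    hNu, hRu, hKu, hKu', zero_apply, sub_apply,
    ContinuousLinearMap.id_apply, id_eq, g_zero_right, g_sub_left u,
    g_smul_left, g_comm u]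
  rw [g_comm (x - C (τ x)) (fderiv ℝ τ x u • _), g_smul_left,
    g_comm (deriv (deriv C) (τ x)) (x - C (τ x))]
  field_simp
  ring

theorem stmt5 (c : ℝ) (hc : 0 < c)
    (C : ℝ → (Fin 4 → ℝ))
    (hC1 : Differentiable ℝ C) (hC2 : Differentiable ℝ (deriv C))
    (hnorm : ∀ s : ℝ, g (deriv C s) (deriv C s) = -c ^ 2)
    (U : Set (Fin 4 → ℝ)) (hU : IsOpen U)
    (τ : (Fin 4 → ℝ) → ℝ)
    (hτ : ∀ y ∈ U, g (y - C (τ y)) (y - C (τ y)) = 0)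
    (x : Fin 4 → ℝ) (hx : x ∈ U)
    (hdiff : DifferentiableAt ℝ τ x)
    (X V A : Fin 4 → ℝ)
    (hX : X = x - C (τ x)) (hV : V = deriv C (τ x))
    (hA : A = deriv (deriv C) (τ x))
    (hne : g X V ≠ 0) :
    ∀ u w : Fin 4 → ℝ,
      DifferentiableAt ℝ
        (fun y => g (deriv C (τ y)) w / g (y - C (τ y)) (deriv C (τ y))) x ∧
      fderiv ℝ (fun y => g (deriv C (τ y)) w / g (y - C (τ y)) (deriv C (τ y))) x u
        - fderiv ℝ (fun y => g (deriv C (τ y)) u / g (y - C (τ y)) (deriv C (τ y))) x w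
        = (g X V * (g X u * g A w - g X w * g A u)
            - (g X A + c ^ 2) * (g X u * g V w - g X w * g V u)) / (g X V) ^ 3 := by
  intro u w
  subst hX hV hA
  have hnull : ∀ᶠ y in nhds x, g (y - C (τ y)) (y - C (τ y)) = 0 :=
    Filter.eventually_of_mem (hU.mem_nhds hx) hτ
  have hgrad := fderiv_retardedTime (hC1 _) hdiff hnull hne
  obtain ⟨L, hL, hLu⟩ := hasFDerivAt_lienardWiechert (hC1 _) (hC2 _) hdiff hne w
  obtain ⟨M, hM, hMu⟩ := hasFDerivAt_lienardWiechert (hC1 _) (hC2 _) hdiff hne u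
  refine ⟨hL.differentiableAt, ?_⟩
  rw [hL.fderiv, hM.fderiv, hLu, hMu, hgrad, hgrad, hnorm]
  field_simp
  ring
end

section
/- (Source-free Maxwell equation for the Liénard–Wiechert field off the worldline.) Let c > 0, let C : ℝ → (Fin 4 → ℝ) be three times differentiable with g (deriv C s) (deriv C s) = -c^2 for all s, let τ be a retarded-time map for C on an open set U, differentiable on U, and suppose g (y - C (τ y)) (deriv C (τ y)) ≠ 0 for all y ∈ U. For y ∈ U write X_y = y - C (τ y), V_y = deriv C (τ y), A_y = deriv (deriv C) (τ y), and define the contravariant field components F y a b = (g X_y V_y * (X_y a * A_y b - X_y b * A_y a) - (g X_y A_y + c^2) * (X_y a * V_y b - X_y b * V_y a)) / (g X_y V_y)^3. Then for every x ∈ U and every b : Fin 4, ∑ (a : Fin 4), fderiv ℝ (fun y => F y a b) x (Pi.single a 1) = 0. -/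
/-- Contravariant components of the Liénard–Wiechert field 2-form. -/
noncomputable def F (c : ℝ) (C : ℝ → (Fin 4 → ℝ)) (τ : (Fin 4 → ℝ) → ℝ)
    (y : Fin 4 → ℝ) (a b : Fin 4) : ℝ :=
  (g (y - C (τ y)) (deriv C (τ y)) *
      ((y - C (τ y)) a * deriv (deriv C) (τ y) b
        - (y - C (τ y)) b * deriv (deriv C) (τ y) a)
    - (g (y - C (τ y)) (deriv (deriv C) (τ y)) + c ^ 2) *
      ((y - C (τ y)) a * deriv C (τ y) b
        - (y - C (τ y)) b * deriv C (τ y) a)) /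
    (g (y - C (τ y)) (deriv C (τ y))) ^ 3

theorem hasFDerivAt_g {u v : (Fin 4 → ℝ) → Fin 4 → ℝ} {x : Fin 4 → ℝ}
    {u' v' : Fin 4 → (Fin 4 → ℝ) →L[ℝ] ℝ}
    (hu : ∀ i, HasFDerivAt (fun y => u y i) (u' i) x)
    (hv : ∀ i, HasFDerivAt (fun y => v y i) (v' i) x) :
    ∃ L : (Fin 4 → ℝ) →L[ℝ] ℝ, HasFDerivAt (fun y => g (u y) (v y)) L x ∧
      ∀ e, L e = g (fun i => u' i e) (v x) + g (u x) (fun i => v' i e) := by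
  refine ⟨_, (((((hu 0).mul (hv 0)).neg).add ((hu 1).mul (hv 1))).add
    ((hu 2).mul (hv 2))).add ((hu 3).mul (hv 3)), fun e => ?_⟩
  simp [g]
  ring

/-- The derivative of `(D (u ∧ w) - E (u ∧ v)) / D ^ 3` for scalar functions. -/
theorem hasFDerivAt_wedge_div_cube {D E p q r s t m : (Fin 4 → ℝ) → ℝ} {x : Fin 4 → ℝ}
    {D' E' p' q' r' s' t' m' : (Fin 4 → ℝ) →L[ℝ] ℝ}
    (hD : HasFDerivAt D D' x) (hE : HasFDerivAt E E' x)
    (hp : HasFDerivAt p p' x) (hq : HasFDerivAt q q' x)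
    (hr : HasFDerivAt r r' x) (hs : HasFDerivAt s s' x)
    (ht : HasFDerivAt t t' x) (hm : HasFDerivAt m m' x) (h0 : D x ≠ 0) :
    ∃ L : (Fin 4 → ℝ) →L[ℝ] ℝ,
      HasFDerivAt (fun y => (D y * (p y * s y - q y * r y) - E y * (p y * m y - q y * t y))
        / D y ^ 3) L x ∧
      ∀ e, L e =
        (D' e * (p x * s x - q x * r x)
          + D x * (p' e * s x + p x * s' e - q' e * r x - q x * r' e)
          - E' e * (p x * m x - q x * t x)
          - E x * (p' e * m x + p x * m' e - q' e * t x - q x * t' e)) / D x ^ 3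
        - 3 * (D x * (p x * s x - q x * r x) - E x * (p x * m x - q x * t x))
          * D' e / D x ^ 4 := by
  have hN := (hD.mul ((hp.mul hs).sub (hq.mul hr))).sub (hE.mul ((hp.mul hm).sub (hq.mul ht)))
  refine ⟨_, hN.mul ((hasDerivAt_inv (pow_ne_zero 3 h0)).comp_hasFDerivAt x (hD.pow 3)),
    fun e => ?_⟩
  simp
  field_simp
  ring

/-- The algebraic identity behind the source-free Maxwell equation, with `k` the reciprocal
of `g X V`. -/
theorem sum_divergence_eq_zero (c D E k : ℝ) (X V A J : Fin 4 → ℝ)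
    (hD : g X V = D) (hE : g X A + c ^ 2 = E) (hk : k * D = 1)
    (hXX : g X X = 0) (hVV : g V V = -c ^ 2) (hVA : g V A = 0) (b : Fin 4) :
    ∑ a : Fin 4,
      (((g V (Pi.single a 1) + g X (Pi.single a 1) * k * E) * (X a * A b - X b * A a)
          + D * ((1 - V a * (g X (Pi.single a 1) * k)) * A b
            + X a * (J b * (g X (Pi.single a 1) * k))
            - ((Pi.single a 1 : Fin 4 → ℝ) b - V b * (g X (Pi.single a 1) * k)) * A a
            - X b * (J a * (g X (Pi.single a 1) * k)))
          - (g A (Pi.single a 1) + g X (Pi.single a 1) * k * g X J) * (X a * V b - X b * V a)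
          - E * ((1 - V a * (g X (Pi.single a 1) * k)) * V b
            + X a * (A b * (g X (Pi.single a 1) * k))
            - ((Pi.single a 1 : Fin 4 → ℝ) b - V b * (g X (Pi.single a 1) * k)) * V a
            - X b * (A a * (g X (Pi.single a 1) * k)))) * k ^ 3
        - 3 * (D * (X a * A b - X b * A a) - E * (X a * V b - X b * V a))
          * (g V (Pi.single a 1) + g X (Pi.single a 1) * k * E) * k ^ 4) = 0 := by
  have key : ∀ p : Fin 4 → ℝ, ∑ a, (Pi.single a 1 : Fin 4 → ℝ) b * p a = p b := fun p => by
    simp [Pi.single_apply]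
  have hA := key A
  have hV := key V
  have hx : ∀ u v : Fin 4 → ℝ, ∑ a, g u (Pi.single a 1) * v a = g u v := fun u v => by
    simp [Fin.sum_univ_four, g]
  have s1 := hx X X
  have s2 := hx X V
  have s3 := hx X A
  have s4 := hx X J
  have s5 := hx V X
  have s6 := hx V V
  have s7 := hx V A
  have s8 := hx A X
  have s9 := hx A V
  have c1 : g V X = D := by rw [← hD]; simp only [g]; ring
  have c2 : g A V = 0 := by rw [← hVA]; simp only [g]; ring
  have c3 : g A X = E - c ^ 2 := by rw [← hE]; simp only [g]; ring
  have c4 : g X A = E - c ^ 2 := by rw [← hE]; ring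
  rw [hXX] at s1
  rw [hD] at s2
  rw [c4] at s3
  rw [c1] at s5
  rw [hVV] at s6
  rw [hVA] at s7
  rw [c3] at s8
  rw [c2] at s9
  generalize g X J = K at *
  have scalar : ((-D * k * A b + k * K * X b) * k ^ 3 - 3 * E ^ 2 * X b * k ^ 5) * D
      + (D * V b * k ^ 4 + 3 * D * X b * E * k ^ 5) * (E - c ^ 2)
      + (-D * X b * k ^ 4) * K
      + (A b * k ^ 3 - 3 * (D * A b - E * V b) * k ^ 4) * D
      + (-3 * E * X b * k ^ 4) * (-c ^ 2)
      + (-V b * k ^ 3) * (E - c ^ 2)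
      + (-D * k ^ 3) * A b
      + (E * k ^ 3) * V b
      + 4 * (D * A b - E * V b) * k ^ 3 = 0 := by
    have hk0 : D ≠ 0 := right_ne_zero_of_mul_eq_one hk
    obtain rfl : k = D⁻¹ := eq_inv_of_mul_eq_one_left hk
    field_simp
    ring
  simp only [Fin.sum_univ_four] at *
  linear_combination ((k * E * A b + D * J b * k - k * K * V b - E * A b * k) * k ^ 3
      - 3 * (D * A b - E * V b) * E * k ^ 5) * s1
    + ((-D * k * A b + k * K * X b) * k ^ 3 - 3 * E ^ 2 * X b * k ^ 5) * s2
    + (D * V b * k ^ 4 + 3 * D * X b * E * k ^ 5) * s3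
    + (-D * X b * k ^ 4) * s4
    + (A b * k ^ 3 - 3 * (D * A b - E * V b) * k ^ 4) * s5
    + (-3 * E * X b * k ^ 4) * s6
    + (-X b * k ^ 3 + 3 * D * X b * k ^ 4) * s7
    + (-V b * k ^ 3) * s8
    + (X b * k ^ 3) * s9
    + (-D * k ^ 3) * hA
    + (E * k ^ 3) * hV + scalar

theorem g_deriv_self_eq_zero {c : ℝ} {C : ℝ → Fin 4 → ℝ} (hC2 : Differentiable ℝ (deriv C))
    (hnorm : ∀ s : ℝ, g (deriv C s) (deriv C s) = -c ^ 2) (s : ℝ) :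
    g (deriv C s) (deriv (deriv C) s) = 0 := by
  have h i := hasDerivAt_pi.1 (hC2 s).hasDerivAt i
  have h1 := (((((h 0).mul (h 0)).neg).add ((h 1).mul (h 1))).add
    ((h 2).mul (h 2))).add ((h 3).mul (h 3))
  have h2 : HasDerivAt (fun t => g (deriv C t) (deriv C t)) 0 s := by
    simp only [hnorm]
    exact hasDerivAt_const _ _
  have h3 := h1.unique h2
  simp only [g]
  linarith

theorem stmt7 (c : ℝ) (hc : 0 < c)
    (C : ℝ → (Fin 4 → ℝ))
    (hC1 : Differentiable ℝ C) (hC2 : Differentiable ℝ (deriv C))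
    (hC3 : Differentiable ℝ (deriv (deriv C)))
    (hnorm : ∀ s : ℝ, g (deriv C s) (deriv C s) = -c ^ 2)
    (U : Set (Fin 4 → ℝ)) (hU : IsOpen U)
    (τ : (Fin 4 → ℝ) → ℝ)
    (hτ : ∀ y ∈ U, g (y - C (τ y)) (y - C (τ y)) = 0)
    (hdiff : ∀ y ∈ U, DifferentiableAt ℝ τ y)
    (hne : ∀ y ∈ U, g (y - C (τ y)) (deriv C (τ y)) ≠ 0) :
    ∀ x ∈ U, ∀ b : Fin 4,
      ∑ a : Fin 4,
        fderiv ℝ (fun y => F c C τ y a b) x (Pi.single a 1) = 0 := by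
  intro x hx b
  have hT := (hdiff x hx).hasFDerivAt
  set T := fderiv ℝ τ x
  have hcomp : ∀ {f : ℝ → Fin 4 → ℝ}, Differentiable ℝ f → ∀ i,
      HasFDerivAt (fun y => f (τ y) i) (deriv f (τ x) i • T) x := fun hf i =>
    (hasDerivAt_pi.1 (hf (τ x)).hasDerivAt i).comp_hasFDerivAt x hT
  have hX : ∀ i, HasFDerivAt (fun y => (y - C (τ y)) i)
      (ContinuousLinearMap.proj i - deriv C (τ x) i • T) x := fun i =>
    (hasFDerivAt_apply i x).sub (hcomp hC1 i)
  have hV := hcomp hC2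
  have hA := hcomp hC3
  have h0 := hne x hx
  have hXX := hτ x hx
  have hVV := hnorm (τ x)
  have hVA := g_deriv_self_eq_zero hC2 hnorm (τ x)
  obtain ⟨N', hN, hN'⟩ := hasFDerivAt_g hX hX
  obtain ⟨D', hD, hD'⟩ := hasFDerivAt_g hX hV
  obtain ⟨G', hG, hG'⟩ := hasFDerivAt_g hX hA
  have hE := hG.add_const (c ^ 2)
  have hN0 : N' = 0 := hN.unique ((hasFDerivAt_const (0 : ℝ) x).congr_of_eventuallyEq
    (Filter.eventually_of_mem (hU.mem_nhds hx) hτ))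
  have hF : ∀ a, _ := fun a => hasFDerivAt_wedge_div_cube hD hE (hX a) (hX b) (hA a) (hA b)
    (hV a) (hV b) h0
  choose L hL hL' using hF
  have hfd : ∀ a, fderiv ℝ (fun y => F c C τ y a b) x = L a := fun a => (hL a).fderiv
  simp only [hfd, hL', hD', hG']
  generalize x - C (τ x) = X at *
  generalize deriv C (τ x) = V at *
  generalize deriv (deriv C) (τ x) = A at *
  generalize deriv (deriv (deriv C)) (τ x) = J at *
  have hTe : ∀ e, T e = g X e * (g X V)⁻¹ := fun e => by
    have h1 := hN' e
    rw [hN0] at h1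
    rw [← div_eq_mul_inv, eq_div_iff h0]
    simp [g] at h1 ⊢
    linarith
  rw [← sum_divergence_eq_zero c (g X V) (g X A + c ^ 2) (g X V)⁻¹ X V A J rfl rfl
    (inv_mul_cancel₀ h0) hXX hVV hVA b]
  refine Finset.sum_congr rfl fun a _ => ?_
  have hDe : g (fun i => (ContinuousLinearMap.proj (R := ℝ) (φ := fun _ : Fin 4 => ℝ) i
      - V i • T) (Pi.single a 1)) V + g X (fun i => (A i • T) (Pi.single a 1))
      = g V (Pi.single a 1) + g X (Pi.single a 1) * (g X V)⁻¹ * (g X A + c ^ 2) := by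
    rw [← hTe]
    simp only [g, sub_apply, smul_apply,
      ContinuousLinearMap.proj_apply, smul_eq_mul] at hVV ⊢
    linear_combination (-T (Pi.single a 1)) * hVV
  have hGe : g (fun i => (ContinuousLinearMap.proj (R := ℝ) (φ := fun _ : Fin 4 => ℝ) i
      - V i • T) (Pi.single a 1)) A + g X (fun i => (J i • T) (Pi.single a 1))
      = g A (Pi.single a 1) + g X (Pi.single a 1) * (g X V)⁻¹ * g X J := by
    rw [← hTe]
    simp only [g, sub_apply, smul_apply,
      ContinuousLinearMap.proj_apply, smul_eq_mul] at hVA ⊢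
    linear_combination (-T (Pi.single a 1)) * hVA
  rw [hDe, hGe]
  simp only [sub_apply, smul_apply,
    ContinuousLinearMap.proj_apply, smul_eq_mul, hTe, Pi.single_eq_same, div_eq_mul_inv, inv_pow]
end

section
/- (Coulomb part of the Liénard–Wiechert electric field in 3-vector form.) Let c > 0, r > 0, and let β n : Fin 3 → ℝ satisfy β ⬝ᵥ β < 1 and n ⬝ᵥ β ≠ 1, and set γ = (1 - β ⬝ᵥ β)^(-1/2). Define X, V : Fin 4 → ℝ by X 0 = r, X i.succ = r * n i, V 0 = c * γ, V i.succ = c * γ * β i (for i : Fin 3). Then for every a : Fin 3, with e_j = Pi.single j (1:ℝ) the standard basis of Fin 4 → ℝ: (-c^2) * (g X (e 0) * g V (e a.succ) - g X (e a.succ) * g V (e 0)) / (g X V)^3 = (n a - β a) / (r^2 * γ^2 * (1 - n ⬝ᵥ β)^3). -/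
open Matrix

/-- The Minkowski form splits into its time part and the Euclidean dot product of space parts. -/
theorem g_eq_dotProduct_succ (u v : Fin 4 → ℝ) :
    g u v = -(u 0 * v 0) + (fun i : Fin 3 => u i.succ) ⬝ᵥ (fun i : Fin 3 => v i.succ) := by
  simp [g, dotProduct, Fin.sum_univ_three, add_assoc]

theorem g_single_zero (u : Fin 4 → ℝ) : g u (Pi.single (0 : Fin 4) (1 : ℝ)) = -u 0 := by
  simp [g]

theorem g_single_succ (u : Fin 4 → ℝ) (a : Fin 3) :
    g u (Pi.single a.succ (1 : ℝ)) = u a.succ := by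
  fin_cases a <;> simp [g]

theorem stmt8 (c r : ℝ) (hc : 0 < c) (hr : 0 < r)
    (β n : Fin 3 → ℝ)
    (hβ : β ⬝ᵥ β < 1) (hnβ : n ⬝ᵥ β ≠ 1)
    (γ : ℝ) (hγ : γ = (1 - β ⬝ᵥ β) ^ (-(1 / 2 : ℝ)))
    (X V : Fin 4 → ℝ)
    (hX0 : X 0 = r) (hXs : ∀ i : Fin 3, X i.succ = r * n i)
    (hV0 : V 0 = c * γ) (hVs : ∀ i : Fin 3, V i.succ = c * γ * β i) :
    ∀ a : Fin 3,
      (-c ^ 2) *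
          (g X (Pi.single (0 : Fin 4) (1 : ℝ)) * g V (Pi.single a.succ (1 : ℝ))
            - g X (Pi.single a.succ (1 : ℝ)) * g V (Pi.single (0 : Fin 4) (1 : ℝ))) /
          (g X V) ^ 3
        = (n a - β a) / (r ^ 2 * γ ^ 2 * (1 - n ⬝ᵥ β) ^ 3) := by
  intro a
  have hγ0 : γ ≠ 0 := by
    rw [hγ]
    exact (Real.rpow_pos_of_pos (sub_pos.mpr hβ) _).ne'
  have hd : 1 - n ⬝ᵥ β ≠ 0 := sub_ne_zero.mpr hnβ.symm
  have hXV : g X V = -(r * c * γ * (1 - n ⬝ᵥ β)) := by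
    rw [g_eq_dotProduct_succ, hX0, hV0]
    simp only [hXs, hVs, dotProduct, Fin.sum_univ_three]
    ring
  rw [hXV, g_single_zero, g_single_zero, g_single_succ, g_single_succ, hX0, hV0, hXs, hVs]
  field_simp
  ring
end

section
/- (The Minkowski metric in Newman–Unti coordinates.) Let c > 0 and let C : ℝ → (Fin 4 → ℝ) be twice differentiable with g (deriv C s) (deriv C s) = -c^2 for all s. For θ φ : ℝ define the null direction n4 θ φ : Fin 4 → ℝ with components (1, sin θ * cos φ, sin θ * sin φ, cos θ), and set α(τ,θ,φ) = g (deriv C τ) (n4 θ φ) and α̇(τ,θ,φ) = g (deriv (deriv C) τ) (n4 θ φ). Define the Newman–Unti coordinate map F : (Fin 4 → ℝ) → (Fin 4 → ℝ) by F (τ,R,θ,φ) = C τ - (R / α(τ,θ,φ)) • n4 θ φ. Let p = (τ,R,θ,φ) with α(τ,θ,φ) ≠ 0. Then F is differentiable at p, and writing D_i = fderiv ℝ F p (Pi.single i 1) for i : Fin 4, the pulled-back metric components are: g D₀ D₀ = -c^2 + 2*R*α̇/α, g D₀ D₁ = -1, g D₂ D₂ = R^2/α^2, g D₃ D₃ =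 R^2 * (sin θ)^2 / α^2, and g D₁ D₁ = 0, g D₀ D₂ = 0, g D₀ D₃ = 0, g D₁ D₂ = 0, g D₁ D₃ = 0, g D₂ D₃ = 0. -/
/-- The null direction with angular coordinates `θ, φ`. -/
noncomputable def n4 (θ φ : ℝ) : Fin 4 → ℝ :=
  ![1, Real.sin θ * Real.cos φ, Real.sin θ * Real.sin φ, Real.cos θ]

/-- `α(τ,θ,φ) = g(Ċ(τ), n(θ,φ))`. -/
noncomputable def alpha (C : ℝ → (Fin 4 → ℝ)) (τ θ φ : ℝ) : ℝ :=
  g (deriv C τ) (n4 θ φ)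

/-- `α̇(τ,θ,φ) = g(C̈(τ), n(θ,φ))`. -/
noncomputable def alphaDot (C : ℝ → (Fin 4 → ℝ)) (τ θ φ : ℝ) : ℝ :=
  g (deriv (deriv C) τ) (n4 θ φ)

/-- The Newman–Unti coordinate map `(τ,R,θ,φ) ↦ C(τ) - (R/α) • n(θ,φ)`. -/
noncomputable def NU (C : ℝ → (Fin 4 → ℝ)) (p : Fin 4 → ℝ) : Fin 4 → ℝ :=
  C (p 0) - (p 1 / alpha C (p 0) (p 2) (p 3)) • n4 (p 2) (p 3)

/-- The partial derivative of `n4` in the polar angle `θ`. -/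
noncomputable def n4Theta (θ φ : ℝ) : Fin 4 → ℝ :=
  ![0, Real.cos θ * Real.cos φ, Real.cos θ * Real.sin φ, -Real.sin θ]

/-- The partial derivative of `n4` in the azimuthal angle `φ`. -/
noncomputable def n4Phi (θ φ : ℝ) : Fin 4 → ℝ :=
  ![0, -(Real.sin θ * Real.sin φ), Real.sin θ * Real.cos φ, 0]

theorem g_add_left (u v w : Fin 4 → ℝ) : g (u + v) w = g u w + g v w := by
  simp only [g, Pi.add_apply]; ring

theorem g_add_right (u v w : Fin 4 → ℝ) : g u (v + w) = g u v + g u w := by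
  simp only [g, Pi.add_apply]; ring

theorem g_smul_right (a : ℝ) (u v : Fin 4 → ℝ) : g u (a • v) = a * g u v := by
  simp only [g, Pi.smul_apply, smul_eq_mul]; ring

theorem g_n4_n4 (θ φ : ℝ) : g (n4 θ φ) (n4 θ φ) = 0 := by
  simp [g, n4]
  linear_combination Real.sin θ ^ 2 * Real.sin_sq_add_cos_sq φ + Real.sin_sq_add_cos_sq θ

theorem g_n4_n4Theta (θ φ : ℝ) : g (n4 θ φ) (n4Theta θ φ) = 0 := by
  simp [g, n4, n4Theta]
  linear_combination Real.sin θ * Real.cos θ * Real.sin_sq_add_cos_sq φ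

theorem g_n4_n4Phi (θ φ : ℝ) : g (n4 θ φ) (n4Phi θ φ) = 0 := by
  simp [g, n4, n4Phi]
  ring

theorem g_n4Theta_n4Theta (θ φ : ℝ) : g (n4Theta θ φ) (n4Theta θ φ) = 1 := by
  simp [g, n4Theta]
  linear_combination Real.cos θ ^ 2 * Real.sin_sq_add_cos_sq φ + Real.sin_sq_add_cos_sq θ

theorem g_n4Theta_n4Phi (θ φ : ℝ) : g (n4Theta θ φ) (n4Phi θ φ) = 0 := by
  simp [g, n4Theta, n4Phi]
  ring

theorem g_n4Phi_n4Phi (θ φ : ℝ) : g (n4Phi θ φ) (n4Phi θ φ) = Real.sin θ ^ 2 := by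
  simp [g, n4Phi]
  linear_combination Real.sin θ ^ 2 * Real.sin_sq_add_cos_sq φ

theorem HasDerivAt.g_apply {u v : ℝ → Fin 4 → ℝ} {u' v' : Fin 4 → ℝ} {t : ℝ}
    (hu : HasDerivAt u u' t) (hv : HasDerivAt v v' t) :
    HasDerivAt (fun s => g (u s) (v s)) (g u' (v t) + g (u t) v') t := by
  have h (i : Fin 4) := (hasDerivAt_pi.1 hu i).fun_mul (hasDerivAt_pi.1 hv i)
  refine ((((h 0).fun_neg.fun_add (h 1)).fun_add (h 2)).fun_add (h 3)).congr_deriv ?_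
  simp only [g]
  ring

theorem HasDerivAt.n4_apply {a b : ℝ → ℝ} {a' b' t : ℝ}
    (ha : HasDerivAt a a' t) (hb : HasDerivAt b b' t) :
    HasDerivAt (fun s => n4 (a s) (b s))
      (a' • n4Theta (a t) (b t) + b' • n4Phi (a t) (b t)) t := by
  rw [hasDerivAt_pi]
  intro i
  fin_cases i
  · simpa [n4, n4Theta, n4Phi] using hasDerivAt_const t (1 : ℝ)
  · refine (ha.sin.fun_mul hb.cos).congr_deriv ?_
    simp [n4Theta, n4Phi]
    ring
  · refine (ha.sin.fun_mul hb.sin).congr_deriv ?_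
    simp [n4Theta, n4Phi]
    ring
  · refine ha.cos.congr_deriv ?_
    simp [n4Theta, n4Phi]
    ring

theorem differentiable_n4 : Differentiable ℝ fun q : ℝ × ℝ => n4 q.1 q.2 := by
  rw [differentiable_pi]
  intro i
  fin_cases i <;> simp [n4] <;> fun_prop

theorem differentiableAt_NU {C : ℝ → Fin 4 → ℝ} (hC1 : Differentiable ℝ C)
    (hC2 : Differentiable ℝ (deriv C)) {p : Fin 4 → ℝ}
    (hα : alpha C (p 0) (p 2) (p 3) ≠ 0) : DifferentiableAt ℝ (NU C) p := by
  have hn : Differentiable ℝ fun q : Fin 4 → ℝ => n4 (q 2) (q 3) :=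
    differentiable_n4.comp (f := fun q : Fin 4 → ℝ => (q 2, q 3)) (by fun_prop)
  have hV : Differentiable ℝ fun q : Fin 4 → ℝ => deriv C (q 0) :=
    hC2.comp (f := fun q : Fin 4 → ℝ => q 0) (by fun_prop)
  have hA : Differentiable ℝ fun q : Fin 4 → ℝ => alpha C (q 0) (q 2) (q 3) := by
    have h1 := differentiable_pi.1 hn
    have h2 := differentiable_pi.1 hV
    unfold alpha g
    fun_prop
  have hR : DifferentiableAt ℝ (fun q : Fin 4 → ℝ => q 1 / alpha C (q 0) (q 2) (q 3)) p := by
    simp only [div_eq_mul_inv]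
    exact (differentiableAt_apply 1 p).fun_mul ((hA p).fun_inv hα)
  exact (hC1.comp (f := fun q : Fin 4 → ℝ => q 0) (by fun_prop)).differentiableAt.fun_sub
    (hR.fun_smul hn.differentiableAt)

theorem fderiv_NU {C : ℝ → Fin 4 → ℝ} (hC1 : Differentiable ℝ C)
    (hC2 : Differentiable ℝ (deriv C)) {p : Fin 4 → ℝ}
    (hα : alpha C (p 0) (p 2) (p 3) ≠ 0) (v : Fin 4 → ℝ) :
    fderiv ℝ (NU C) p v =
      v 0 • deriv C (p 0)
        + ((p 1 * (v 0 * alphaDot C (p 0) (p 2) (p 3)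
              + v 2 * g (deriv C (p 0)) (n4Theta (p 2) (p 3))
              + v 3 * g (deriv C (p 0)) (n4Phi (p 2) (p 3)))
            - v 1 * alpha C (p 0) (p 2) (p 3)) / alpha C (p 0) (p 2) (p 3) ^ 2) •
          n4 (p 2) (p 3)
        + (-(p 1 / alpha C (p 0) (p 2) (p 3)) * v 2) • n4Theta (p 2) (p 3)
        + (-(p 1 / alpha C (p 0) (p 2) (p 3)) * v 3) • n4Phi (p 2) (p 3) := by
  have hline (i : Fin 4) : HasDerivAt (fun t : ℝ => p i + t * v i) (v i) 0 := by
    simpa using ((hasDerivAt_id (0 : ℝ)).mul_const (v i)).const_add (p i)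
  have hC := (hC1 (p 0 + 0 * v 0)).hasDerivAt.scomp (0 : ℝ) (hline 0)
  have hV := (hC2 (p 0 + 0 * v 0)).hasDerivAt.scomp (0 : ℝ) (hline 0)
  have hn := (hline 2).n4_apply (hline 3)
  have hA := hV.g_apply hn
  have hF := hC.fun_sub (((hline 1).fun_div hA (by simpa [alpha] using hα)).fun_smul hn)
  have hL := (differentiableAt_NU hC1 hC2 hα).hasFDerivAt.hasLineDerivAt v
  rw [HasLineDerivAt] at hL
  refine hL.unique (hF.congr_deriv ?_)
  simp only [Function.comp_apply, zero_mul, add_zero, g_smul_left, g_add_right, g_smul_right]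
  ext i
  simp only [alpha, alphaDot, Pi.add_apply, Pi.sub_apply, Pi.smul_apply, smul_eq_mul]
  ring

theorem stmt10 (c : ℝ) (hc : 0 < c)
    (C : ℝ → (Fin 4 → ℝ))
    (hC1 : Differentiable ℝ C) (hC2 : Differentiable ℝ (deriv C))
    (hnorm : ∀ s : ℝ, g (deriv C s) (deriv C s) = -c ^ 2)
    (p : Fin 4 → ℝ)
    (hα : alpha C (p 0) (p 2) (p 3) ≠ 0) :
    DifferentiableAt ℝ (NU C) p ∧
    ∀ D : Fin 4 → (Fin 4 → ℝ),
      (∀ i : Fin 4, D i = fderiv ℝ (NU C) p (Pi.single i 1)) →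
      g (D 0) (D 0)
          = -c ^ 2 + 2 * p 1 * alphaDot C (p 0) (p 2) (p 3) / alpha C (p 0) (p 2) (p 3) ∧
      g (D 0) (D 1) = -1 ∧
      g (D 2) (D 2) = (p 1) ^ 2 / (alpha C (p 0) (p 2) (p 3)) ^ 2 ∧
      g (D 3) (D 3) = (p 1) ^ 2 * (Real.sin (p 2)) ^ 2 / (alpha C (p 0) (p 2) (p 3)) ^ 2 ∧
      g (D 1) (D 1) = 0 ∧ g (D 0) (D 2) = 0 ∧ g (D 0) (D 3) = 0 ∧
      g (D 1) (D 2) = 0 ∧ g (D 1) (D 3) = 0 ∧ g (D 2) (D 3) = 0 := by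
  refine ⟨differentiableAt_NU hC1 hC2 hα, fun D hD => ?_⟩
  have hVV := hnorm (p 0)
  have hVn : g (deriv C (p 0)) (n4 (p 2) (p 3)) = alpha C (p 0) (p 2) (p 3) := rfl
  simp only [hD, fderiv_NU hC1 hC2 hα, g_add_left, g_add_right, g_smul_left, g_smul_right,
    g_comm (n4 _ _) (deriv C _), g_comm (n4Theta _ _) (deriv C _), g_comm (n4Phi _ _) (deriv C _),
    g_comm (n4Theta _ _) (n4 _ _), g_comm (n4Phi _ _) (n4 _ _), g_comm (n4Phi _ _) (n4Theta _ _),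
    g_n4_n4, g_n4_n4Theta, g_n4_n4Phi, g_n4Theta_n4Theta, g_n4Theta_n4Phi, g_n4Phi_n4Phi,
    hVV, hVn]
  refine ⟨?_, ?_, ?_, ?_, ?_, ?_, ?_, ?_, ?_, ?_⟩ <;> simp <;> field_simp <;> ring
end

section
/- (Exterior derivative of the Dirac time.) Let C : ℝ → (Fin 4 → ℝ) be twice differentiable with g (deriv C s) (deriv C s) = -1 for every s, let U be an open subset of Fin 4 → ℝ, and let τ_D : (Fin 4 → ℝ) → ℝ satisfy g (y - C (τ_D y)) (deriv C (τ_D y)) = 0 for every y ∈ U. Let x ∈ U with τ_D differentiable at x, write Y = x - C (τ_D x), V_D = deriv C (τ_D x), A_D = deriv (deriv C) (τ_D x), and assume g Y A_D + 1 ≠ 0. Then for every v : Fin 4 → ℝ, fderiv ℝ τ_D x v = - g V_D v / (g Y A_D + 1). -/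
theorem HasDerivAt.minkowski {a b : ℝ → Fin 4 → ℝ} {a' b' : Fin 4 → ℝ} {t : ℝ}
    (ha : HasDerivAt a a' t) (hb : HasDerivAt b b' t) :
    HasDerivAt (fun s => g (a s) (b s)) (g a' (b t) + g (a t) b') t := by
  have hm (i : Fin 4) := (hasDerivAt_pi.1 ha i).mul (hasDerivAt_pi.1 hb i)
  refine ((((hm 0).neg.add (hm 1)).add (hm 2)).add (hm 3)).congr_deriv ?_
  simp only [g]
  ring

theorem stmt12 (C : ℝ → (Fin 4 → ℝ))
    (hC1 : Differentiable ℝ C) (hC2 : Differentiable ℝ (deriv C))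
    (hnorm : ∀ s : ℝ, g (deriv C s) (deriv C s) = -1)
    (U : Set (Fin 4 → ℝ)) (hU : IsOpen U)
    (τD : (Fin 4 → ℝ) → ℝ)
    (hτD : ∀ y ∈ U, g (y - C (τD y)) (deriv C (τD y)) = 0)
    (x : Fin 4 → ℝ) (hx : x ∈ U)
    (hdiff : DifferentiableAt ℝ τD x)
    (Y VD AD : Fin 4 → ℝ)
    (hY : Y = x - C (τD x)) (hVD : VD = deriv C (τD x))
    (hAD : AD = deriv (deriv C) (τD x))
    (hne : g Y AD + 1 ≠ 0) :
    ∀ v : Fin 4 → ℝ, fderiv ℝ τD x v = - g VD v / (g Y AD + 1) := by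
  intro v
  subst hY hVD hAD
  have hline : HasDerivAt (fun t : ℝ => x + t • v) v 0 := by
    simpa using ((hasDerivAt_id (0 : ℝ)).smul_const v).const_add x
  have hx0 : x + (0 : ℝ) • v = x := by simp
  have hτ : HasDerivAt (fun t : ℝ => τD (x + t • v)) (fderiv ℝ τD x v) 0 :=
    HasFDerivAt.comp_hasDerivAt (0 : ℝ) (f := fun t : ℝ => x + t • v)
      (by simpa only [hx0] using hdiff.hasFDerivAt) hline
  have hC : HasDerivAt (fun t : ℝ => C (τD (x + t • v)))
      (fderiv ℝ τD x v • deriv C (τD x)) 0 :=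
    HasDerivAt.scomp (0 : ℝ) (g₁ := C) (h := fun t : ℝ => τD (x + t • v))
      (by simpa only [hx0] using (hC1 (τD x)).hasDerivAt) hτ
  have hV : HasDerivAt (fun t : ℝ => deriv C (τD (x + t • v)))
      (fderiv ℝ τD x v • deriv (deriv C) (τD x)) 0 :=
    HasDerivAt.scomp (0 : ℝ) (g₁ := deriv C) (h := fun t : ℝ => τD (x + t • v))
      (by simpa only [hx0] using (hC2 (τD x)).hasDerivAt) hτ
  have hF := (hline.sub hC).minkowski hV
  have hmem : ∀ᶠ t : ℝ in nhds 0, x + t • v ∈ U :=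
    hline.continuousAt.eventually (hU.mem_nhds (by simpa only [hx0] using hx))
  have hzero := hF.unique ((hasDerivAt_const (0 : ℝ) (0 : ℝ)).congr_of_eventuallyEq
    (hmem.mono fun t ht => hτD _ ht))
  have hn := hnorm (τD x)
  rw [eq_div_iff hne]
  simp only [g, hx0, Pi.sub_apply, Pi.smul_apply, smul_eq_mul] at hzero hn ⊢
  linear_combination hzero + fderiv ℝ τD x v * hn
end

section
/- (Exterior derivative of the Dirac radius.) Under the hypotheses of the Dirac-time setup — C : ℝ → (Fin 4 → ℝ) twice differentiable with g (deriv C s) (deriv C s) = -1 for all s, τ_D : (Fin 4 → ℝ) → ℝ with g (y - C (τ_D y)) (deriv C (τ_D y)) = 0 for all y in an open set U, x ∈ U, τ_D differentiable at x, Y = x - C (τ_D x), A_D = deriv (deriv C) (τ_D x), g Y A_D + 1 ≠ 0 — assume additionally g Y Y > 0. Then the function R_D : y ↦ Real.sqrt (g (y - C (τ_D y)) (y - C (τ_D y))) is differentiable at x and for every v : Fin 4 → ℝ, fderiv ℝ R_D x v = g Y v / Real.sqrt (g Y Y). -/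
theorem hasFDerivAt_sub_comp_apply {C : ℝ → (Fin 4 → ℝ)} {τ : (Fin 4 → ℝ) → ℝ}
    {x : Fin 4 → ℝ} (hC : DifferentiableAt ℝ C (τ x)) (hτ : DifferentiableAt ℝ τ x)
    (i : Fin 4) :
    HasFDerivAt (fun y : Fin 4 → ℝ => (y - C (τ y)) i)
      (ContinuousLinearMap.proj (R := ℝ) (φ := fun _ : Fin 4 => ℝ) i
        - deriv C (τ x) i • fderiv ℝ τ x) x :=
  (hasFDerivAt_apply i x).sub
    ((hasDerivAt_pi.1 hC.hasDerivAt i).comp_hasFDerivAt x hτ.hasFDerivAt)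

theorem stmt13 (C : ℝ → (Fin 4 → ℝ))
    (hC1 : Differentiable ℝ C) (hC2 : Differentiable ℝ (deriv C))
    (hnorm : ∀ s : ℝ, g (deriv C s) (deriv C s) = -1)
    (U : Set (Fin 4 → ℝ)) (hU : IsOpen U)
    (τD : (Fin 4 → ℝ) → ℝ)
    (hτD : ∀ y ∈ U, g (y - C (τD y)) (deriv C (τD y)) = 0)
    (x : Fin 4 → ℝ) (hx : x ∈ U)
    (hdiff : DifferentiableAt ℝ τD x)
    (Y AD : Fin 4 → ℝ)
    (hY : Y = x - C (τD x))
    (hAD : AD = deriv (deriv C) (τD x))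
    (hne : g Y AD + 1 ≠ 0)
    (hYY : 0 < g Y Y) :
    DifferentiableAt ℝ
      (fun y => Real.sqrt (g (y - C (τD y)) (y - C (τD y)))) x ∧
    ∀ v : Fin 4 → ℝ,
      fderiv ℝ (fun y => Real.sqrt (g (y - C (τD y)) (y - C (τD y)))) x v
        = g Y v / Real.sqrt (g Y Y) := by
  have hZ := hasFDerivAt_sub_comp_apply (hC1 (τD x)) hdiff
  have horth := hτD x hx
  rw [← hY] at horth
  have hsq := ((((hZ 0).mul (hZ 0)).neg.add ((hZ 1).mul (hZ 1))).add
    ((hZ 2).mul (hZ 2))).add ((hZ 3).mul (hZ 3))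
  have hpos : g (x - C (τD x)) (x - C (τD x)) ≠ 0 := by
    rw [← hY]
    exact hYY.ne'
  have hR := HasFDerivAt.sqrt (f := fun y => g (y - C (τD y)) (y - C (τD y))) hsq hpos
  refine ⟨hR.differentiableAt, fun v => ?_⟩
  rw [hR.fderiv, ← hY]
  have hs : Real.sqrt (g Y Y) ≠ 0 := (Real.sqrt_pos.2 hYY).ne'
  simp only [smul_apply, add_apply,
    neg_apply, sub_apply,
    ContinuousLinearMap.proj_apply, smul_eq_mul]
  field_simp
  simp only [g] at horth ⊢
  linear_combination (-2 * fderiv ℝ τD x v) * horth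
end

section
/- (Derivative of g(Y, A_D) in Dirac geometry.) Let C : ℝ → (Fin 4 → ℝ) be three times differentiable with g (deriv C s) (deriv C s) = -1 for every s, let τ_D : (Fin 4 → ℝ) → ℝ satisfy g (y - C (τ_D y)) (deriv C (τ_D y)) = 0 for every y in an open set U, let x ∈ U with τ_D differentiable at x, write Y = x - C (τ_D x), V_D = deriv C (τ_D x), A_D = deriv (deriv C) (τ_D x), Ȧ_D = deriv (deriv (deriv C)) (τ_D x), and assume g Y A_D + 1 ≠ 0. Then the function y ↦ g (y - C (τ_D y)) (deriv (deriv C) (τ_D y)) is differentiable at x and its Fréchet derivative at x sends v to g A_D v - (g Y Ȧ_D / (g Y A_D + 1)) * g V_D v. -/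
/-- The Minkowski form as a continuous bilinear map. -/
noncomputable def gBilin : (Fin 4 → ℝ) →L[ℝ] (Fin 4 → ℝ) →L[ℝ] ℝ :=
  LinearMap.toContinuousBilinearMap <| LinearMap.mk₂ ℝ g
    (fun u u' v => by simp only [g, Pi.add_apply]; ring)
    (fun c u v => by simp only [g, Pi.smul_apply, smul_eq_mul]; ring)
    (fun u v v' => by simp only [g, Pi.add_apply]; ring)
    (fun c u v => by simp only [g, Pi.smul_apply, smul_eq_mul]; ring)

theorem gBilin_apply (u v : Fin 4 → ℝ) : gBilin u v = g u v := rfl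

/-- Derivative of the pairing of the displacement `y - C (τ y)` with a vector field `W` along the
curve `C`, where `τ` is any differentiable choice of parameter. -/
theorem hasFDerivAt_g_displacement {C W : ℝ → (Fin 4 → ℝ)} {τ : (Fin 4 → ℝ) → ℝ}
    {x : Fin 4 → ℝ} (hC : DifferentiableAt ℝ C (τ x)) (hW : DifferentiableAt ℝ W (τ x))
    (hτ : DifferentiableAt ℝ τ x) :
    ∃ L : (Fin 4 → ℝ) →L[ℝ] ℝ, HasFDerivAt (fun y => g (y - C (τ y)) (W (τ y))) L x ∧
      ∀ v, L v = g v (W (τ x)) +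
        fderiv ℝ τ x v * (g (x - C (τ x)) (deriv W (τ x)) - g (deriv C (τ x)) (W (τ x))) := by
  have hd := (hasFDerivAt_id (𝕜 := ℝ) x).sub
    (hC.hasDerivAt.hasFDerivAt.comp x hτ.hasFDerivAt)
  have hw := hW.hasDerivAt.hasFDerivAt.comp x hτ.hasFDerivAt
  refine ⟨_, gBilin.hasFDerivAt_of_bilinear hd hw, fun v => ?_⟩
  simp [← gBilin_apply]
  ring

/-- The acceleration of a curve of constant Minkowski square is orthogonal to its velocity. -/
theorem g_deriv_eq_zero_of_const_s14 {V : ℝ → (Fin 4 → ℝ)} {c s : ℝ}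
    (hV : DifferentiableAt ℝ V s) (h : ∀ t, g (V t) (V t) = c) :
    g (V s) (deriv V s) = 0 := by
  have hd := gBilin.hasFDerivAt_of_bilinear hV.hasDerivAt.hasFDerivAt hV.hasDerivAt.hasFDerivAt
  have hc : (fun t => gBilin (V t) (V t)) = fun _ => c := funext h
  rw [hc] at hd
  have h1 := DFunLike.congr_fun (hd.unique (hasFDerivAt_const c s)) 1
  simp [gBilin_apply] at h1
  rw [g_comm (deriv V s)] at h1
  linarith


theorem stmt14 (C : ℝ → (Fin 4 → ℝ))
    (hC1 : Differentiable ℝ C) (hC2 : Differentiable ℝ (deriv C))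
    (hC3 : Differentiable ℝ (deriv (deriv C)))
    (hnorm : ∀ s : ℝ, g (deriv C s) (deriv C s) = -1)
    (U : Set (Fin 4 → ℝ)) (hU : IsOpen U)
    (τD : (Fin 4 → ℝ) → ℝ)
    (hτD : ∀ y ∈ U, g (y - C (τD y)) (deriv C (τD y)) = 0)
    (x : Fin 4 → ℝ) (hx : x ∈ U)
    (hdiff : DifferentiableAt ℝ τD x)
    (Y VD AD ADdot : Fin 4 → ℝ)
    (hY : Y = x - C (τD x)) (hVD : VD = deriv C (τD x))
    (hAD : AD = deriv (deriv C) (τD x))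
    (hADdot : ADdot = deriv (deriv (deriv C)) (τD x))
    (hne : g Y AD + 1 ≠ 0) :
    DifferentiableAt ℝ
      (fun y => g (y - C (τD y)) (deriv (deriv C) (τD y))) x ∧
    ∀ v : Fin 4 → ℝ,
      fderiv ℝ (fun y => g (y - C (τD y)) (deriv (deriv C) (τD y))) x v
        = g AD v - (g Y ADdot / (g Y AD + 1)) * g VD v := by
  subst hY hVD hAD hADdot
  obtain ⟨L, hL, hLv⟩ := hasFDerivAt_g_displacement (hC1 (τD x)) (hC3 (τD x)) hdiff
  obtain ⟨M, hM, hMv⟩ := hasFDerivAt_g_displacement (hC1 (τD x)) (hC2 (τD x)) hdiff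
  have hM0 : M = 0 := by
    refine hM.unique ((hasFDerivAt_const (0 : ℝ) x).congr_of_eventuallyEq ?_)
    filter_upwards [hU.mem_nhds hx] with y hy using hτD y hy
  refine ⟨hL.differentiableAt, fun v => ?_⟩
  have hv := hMv v
  rw [hM0, hnorm, zero_apply, g_comm v] at hv
  have hτ : fderiv ℝ τD x v = -g (deriv C (τD x)) v /
      (g (x - C (τD x)) (deriv (deriv C) (τD x)) + 1) := by
    rw [eq_div_iff hne]
    linarith
  rw [hL.fderiv, hLv, g_deriv_eq_zero_of_const_s14 (hC2 (τD x)) hnorm, hτ, g_comm v]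
  ring
end

section
/- (4-velocity and 4-acceleration in 3-vector form.) Let c > 0 and let x : ℝ → (Fin 3 → ℝ) be twice differentiable. Define β t = (1/c) • deriv x t and assume β t ⬝ᵥ β t < 1 for all t; set γ t = (1 - β t ⬝ᵥ β t)^(-1/2) and a t = deriv β t. Let T : ℝ → ℝ be differentiable with deriv T τ = γ (T τ) for all τ (lab time as a function of proper time), and define the worldline C : ℝ → (Fin 4 → ℝ) by C τ 0 = c * T τ and C τ i.succ = x (T τ) i for i : Fin 3. Then for every τ, writing t = T τ: (i) (deriv C τ) 0 = c * γ t and (deriv C τ) i.succ = c * γ t * β t i; (ii) (deriv (deriv C) τ) 0 = c * (γ t)^4 * (a t ⬝ᵥ β t) and (deriv (deriv C) τ) i.succ = c * (γ t)^4 * (a t ⬝ᵥ β t) * β t i + c * (γ t)^2 * a t i. -/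
open Matrix

theorem HasDerivAt.dotProduct {ι : Type*} [Fintype ι] {u v : ℝ → ι → ℝ} {u' v' : ι → ℝ} {t : ℝ}
    (hu : HasDerivAt u u' t) (hv : HasDerivAt v v' t) :
    HasDerivAt (fun s => u s ⬝ᵥ v s) (u' ⬝ᵥ v t + u t ⬝ᵥ v') t := by
  simp only [_root_.dotProduct, ← Finset.sum_add_distrib]
  exact HasDerivAt.fun_sum fun i _ => (hasDerivAt_pi.1 hu i).mul (hasDerivAt_pi.1 hv i)

theorem hasDerivAt_lorentzFactor {ι : Type*} [Fintype ι] {β : ℝ → ι → ℝ} {a : ι → ℝ} {t : ℝ}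
    (hβ : HasDerivAt β a t) (hlt : β t ⬝ᵥ β t < 1) :
    HasDerivAt (fun s => (1 - β s ⬝ᵥ β s) ^ (-(1 / 2 : ℝ)))
      (((1 - β t ⬝ᵥ β t) ^ (-(1 / 2 : ℝ))) ^ 3 * (a ⬝ᵥ β t)) t := by
  have hpos : 0 < 1 - β t ⬝ᵥ β t := sub_pos.2 hlt
  convert ((hβ.dotProduct hβ).const_sub 1).rpow_const (p := -(1 / 2 : ℝ)) (.inl hpos.ne') using 1
  rw [← Real.rpow_mul_natCast hpos.le, dotProduct_comm (β t) a]
  norm_num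
  ring

theorem hasDerivAt_fin_succ {n : ℕ} {f : ℝ → Fin (n + 1) → ℝ} {f₀ : ℝ} {v : Fin n → ℝ} {t : ℝ}
    (h₀ : HasDerivAt (fun s => f s 0) f₀ t)
    (hs : ∀ i : Fin n, HasDerivAt (fun s => f s i.succ) (v i) t) :
    HasDerivAt f (Fin.cons f₀ v : Fin (n + 1) → ℝ) t :=
  hasDerivAt_pi.2 <| Fin.cases h₀ hs

theorem stmt15 (c : ℝ) (hc : 0 < c)
    (x : ℝ → (Fin 3 → ℝ))
    (hx1 : Differentiable ℝ x) (hx2 : Differentiable ℝ (deriv x))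
    (β : ℝ → (Fin 3 → ℝ)) (hβ : ∀ t, β t = (1 / c) • deriv x t)
    (hβlt : ∀ t, β t ⬝ᵥ β t < 1)
    (γ : ℝ → ℝ) (hγ : ∀ t, γ t = (1 - β t ⬝ᵥ β t) ^ (-(1 / 2 : ℝ)))
    (a : ℝ → (Fin 3 → ℝ)) (ha : ∀ t, a t = deriv β t)
    (T : ℝ → ℝ) (hT : Differentiable ℝ T)
    (hT' : ∀ τ, deriv T τ = γ (T τ))
    (C : ℝ → (Fin 4 → ℝ))
    (hC0 : ∀ τ, C τ 0 = c * T τ)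
    (hCs : ∀ τ, ∀ i : Fin 3, C τ i.succ = x (T τ) i) :
    ∀ τ : ℝ,
      (deriv C τ 0 = c * γ (T τ) ∧
        ∀ i : Fin 3, deriv C τ i.succ = c * γ (T τ) * β (T τ) i) ∧
      (deriv (deriv C) τ 0 = c * (γ (T τ)) ^ 4 * (a (T τ) ⬝ᵥ β (T τ)) ∧
        ∀ i : Fin 3,
          deriv (deriv C) τ i.succ
            = c * (γ (T τ)) ^ 4 * (a (T τ) ⬝ᵥ β (T τ)) * β (T τ) i
              + c * (γ (T τ)) ^ 2 * a (T τ) i) := by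
  have hxβ : ∀ t, HasDerivAt x (c • β t) t := fun t => by
    rw [hβ, smul_smul, mul_one_div_cancel hc.ne', one_smul]
    exact (hx1 t).hasDerivAt
  have hβa : ∀ t, HasDerivAt β (a t) t := fun t => by
    rw [ha, funext hβ]
    exact ((hx2 t).const_smul (1 / c)).hasDerivAt
  have hTγ : ∀ τ, HasDerivAt T (γ (T τ)) τ := fun τ => hT' τ ▸ (hT τ).hasDerivAt
  have hγ' : ∀ t, HasDerivAt γ (γ t ^ 3 * (a t ⬝ᵥ β t)) t := fun t => by
    rw [funext hγ]
    exact hasDerivAt_lorentzFactor (hβa t) (hβlt t)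
  have hC : ∀ τ, HasDerivAt C
      (Fin.cons (c * γ (T τ)) fun i => c * γ (T τ) * β (T τ) i : Fin 4 → ℝ) τ := fun τ => by
    refine hasDerivAt_fin_succ ?_ fun i => ?_
    · simp only [hC0]
      exact (hTγ τ).const_mul c
    · simp only [hCs]
      refine ((hasDerivAt_pi.1 (hxβ (T τ)) i).comp τ (hTγ τ)).congr_deriv ?_
      simp only [Pi.smul_apply, smul_eq_mul]
      ring
  have hγT : ∀ τ, HasDerivAt (fun s => c * γ (T s)) (c * γ (T τ) ^ 4 * (a (T τ) ⬝ᵥ β (T τ))) τ :=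
    fun τ => by
      refine (((hγ' (T τ)).comp τ (hTγ τ)).const_mul c).congr_deriv ?_
      ring
  have hC' : ∀ τ, HasDerivAt (deriv C)
      (Fin.cons (c * γ (T τ) ^ 4 * (a (T τ) ⬝ᵥ β (T τ))) fun i =>
        c * γ (T τ) ^ 4 * (a (T τ) ⬝ᵥ β (T τ)) * β (T τ) i + c * γ (T τ) ^ 2 * a (T τ) i :
        Fin 4 → ℝ) τ := fun τ => by
    rw [funext fun s => (hC s).deriv]
    refine hasDerivAt_fin_succ ?_ fun i => ?_
    · simpa only [Fin.cons_zero] using hγT τ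
    · simp only [Fin.cons_succ]
      refine ((hγT τ).mul ((hasDerivAt_pi.1 (hβa (T τ)) i).comp τ (hTγ τ))).congr_deriv ?_
      simp only [Function.comp_apply]
      ring
  intro τ
  rw [(hC τ).deriv, (hC' τ).deriv]
  exact ⟨⟨rfl, fun _ => rfl⟩, rfl, fun _ => rfl⟩
end

section
/- (The solid-angle integral of the inverse square of the retarded factor.) Let v₀ v₁ v₂ v₃ : ℝ with v₀ > Real.sqrt (v₁^2 + v₂^2 + v₃^2). Then ∫ θ in (0:ℝ)..π, ∫ φ in (0:ℝ)..(2*π), Real.sin θ / (v₀ - v₁ * Real.sin θ * Real.cos φ - v₂ * Real.sin θ * Real.sin φ - v₃ * Real.cos θ)^2 = 4 * π / (v₀^2 - v₁^2 - v₂^2 - v₃^2). In particular, when (v₀,v₁,v₂,v₃) are the components of a future-pointing 4-velocity with v₀^2 - v₁^2 - v₂^2 - v₃^2 = c^2, the integral of c²·sin θ / α(θ,φ)² over the sphere equals 4π, where α(θ,φ) = -v₀ + v₁ sin θ cos φ + v₂ sin θ sin φ + v₃ cos θ. -/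
open Real

/-- The integral over a full period of the inverse square of `a - b cos φ - c sin φ`. -/
theorem integral_inv_sq_sub_cos_sub_sin {a b c : ℝ} (ha : 0 < a) (h : 0 < a ^ 2 - b ^ 2 - c ^ 2) :
    ∫ φ in (0 : ℝ)..(2 * π), 1 / (a - b * cos φ - c * sin φ) ^ 2
      = 2 * π * a / √(a ^ 2 - b ^ 2 - c ^ 2) ^ 3 := by
  have hD : ∀ φ : ℝ, 0 < a - b * cos φ - c * sin φ := fun φ ↦ by
    have hX : (b * cos φ + c * sin φ) ^ 2 < a ^ 2 := by
      nlinarith [sq_nonneg (b * sin φ - c * cos φ), sin_sq_add_cos_sq φ]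
    linarith [(abs_lt_of_sq_lt_sq' hX ha.le).2]
  set S := √(a ^ 2 - b ^ 2 - c ^ 2) with hS
  have hS0 : 0 < S := sqrt_pos.2 h
  have hS2 : S ^ 2 = a ^ 2 - b ^ 2 - c ^ 2 := sq_sqrt h.le
  have hderiv : ∀ φ : ℝ, HasDerivAt (fun φ ↦ 1 / S ^ 2 *
      ((b * sin φ - c * cos φ) / (a - b * cos φ - c * sin φ) + a * (φ / S + 2 / S *
        arctan ((b * sin φ - c * cos φ) / (a + S - b * cos φ - c * sin φ)))))
      (1 / (a - b * cos φ - c * sin φ) ^ 2) φ := fun φ ↦ by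
    have hY : HasDerivAt (fun φ ↦ b * sin φ - c * cos φ) (b * cos φ - c * -sin φ) φ :=
      ((hasDerivAt_sin φ).const_mul b).sub ((hasDerivAt_cos φ).const_mul c)
    have hX (k : ℝ) : HasDerivAt (fun φ ↦ k - b * cos φ - c * sin φ)
        (-(b * -sin φ) - c * cos φ) φ :=
      (((hasDerivAt_cos φ).const_mul b).const_sub k).sub ((hasDerivAt_sin φ).const_mul c)
    have hd := hD φ
    have he : 0 < a + S - b * cos φ - c * sin φ := by linarith
    refine ((((hY.div (hX a) hd.ne').add ((((hasDerivAt_id φ).div_const S).add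
      (((hY.div (hX (a + S)) he.ne').arctan).const_mul (2 / S))).const_mul a)).const_mul
        (1 / S ^ 2))).congr_deriv ?_
    simp only [Pi.div_apply]
    have hsq : (b * sin φ - c * cos φ) ^ 2 = a ^ 2 - S ^ 2 - (b * cos φ + c * sin φ) ^ 2 := by
      linear_combination (b ^ 2 + c ^ 2) * sin_sq_add_cos_sq φ + hS2
    generalize hy : b * sin φ - c * cos φ = Y at *
    have e1 : a - b * cos φ - c * sin φ = a - (b * cos φ + c * sin φ) := by ring
    have e2 : a + S - b * cos φ - c * sin φ = a - (b * cos φ + c * sin φ) + S := by ring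
    have e3 : -(b * -sin φ) - c * cos φ = Y := by rw [← hy]; ring
    have e4 : b * cos φ - c * -sin φ = b * cos φ + c * sin φ := by ring
    rw [e1] at hd
    rw [e2, e1] at *
    rw [e3, e4]
    generalize b * cos φ + c * sin φ = X at *
    obtain ⟨D, rfl⟩ : ∃ D, X = a - D := ⟨a - X, by ring⟩
    simp only [sub_sub_cancel] at *
    have hsum : (D + S) ^ 2 + Y ^ 2 = 2 * D * (a + S) := by linear_combination hsq
    have harc : 1 / (1 + (Y / (D + S)) ^ 2) = (D + S) ^ 2 / (2 * D * (a + S)) := by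
      rw [← hsum]
      field_simp
    have haS : 0 < a + S := by positivity
    rw [harc]
    field_simp
    linear_combination (-(S * (a + S)) - a * D) * hsq
  rw [intervalIntegral.integral_eq_sub_of_hasDerivAt (fun φ _ ↦ hderiv φ)
    (Continuous.intervalIntegrable (by
      refine continuous_const.div (by fun_prop) fun φ ↦ (pow_pos (hD φ) 2).ne') _ _)]
  simp only [sin_two_pi, cos_two_pi, sin_zero, cos_zero]
  field_simp
  ring

theorem stmt19 (v₀ v₁ v₂ v₃ : ℝ)
    (hv : Real.sqrt (v₁ ^ 2 + v₂ ^ 2 + v₃ ^ 2) < v₀) :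
    ∫ θ in (0 : ℝ)..π, ∫ φ in (0 : ℝ)..(2 * π),
        Real.sin θ /
          (v₀ - v₁ * Real.sin θ * Real.cos φ - v₂ * Real.sin θ * Real.sin φ
            - v₃ * Real.cos θ) ^ 2
      = 4 * π / (v₀ ^ 2 - v₁ ^ 2 - v₂ ^ 2 - v₃ ^ 2) := by
  have hv₀ : 0 < v₀ := (sqrt_nonneg _).trans_lt hv
  have hm : 0 < v₀ ^ 2 - v₁ ^ 2 - v₂ ^ 2 - v₃ ^ 2 := by
    linarith [(sqrt_lt' hv₀).1 hv]
  have hv₃ := abs_lt_of_sq_lt_sq' (a := v₃) (b := v₀)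
    (by nlinarith [sq_nonneg v₁, sq_nonneg v₂]) hv₀.le
  have hA (θ : ℝ) : 0 < v₀ - v₃ * cos θ := by
    have h : |v₃ * cos θ| ≤ |v₃| := by
      rw [abs_mul]
      exact mul_le_of_le_one_right (abs_nonneg _) (abs_cos_le_one θ)
    linarith [le_abs_self (v₃ * cos θ), abs_lt.2 hv₃]
  have hQ (θ : ℝ) : 0 < (v₀ - v₃ * cos θ) ^ 2 - (v₁ * sin θ) ^ 2 - (v₂ * sin θ) ^ 2 := by
    have hcs := sin_sq_add_cos_sq θ
    have key : (v₀ - v₃ * cos θ) ^ 2 - (v₁ * sin θ) ^ 2 - (v₂ * sin θ) ^ 2 =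
        (v₃ - v₀ * cos θ) ^ 2 + sin θ ^ 2 * (v₀ ^ 2 - v₁ ^ 2 - v₂ ^ 2 - v₃ ^ 2) := by
      linear_combination (v₃ ^ 2 - v₀ ^ 2) * hcs
    rcases eq_or_ne (sin θ) 0 with hs | hs
    · simpa [hs] using pow_pos (hA θ) 2
    · rw [key]
      positivity
  have hinner (θ : ℝ) : ∫ φ in (0 : ℝ)..(2 * π), sin θ /
      (v₀ - v₁ * sin θ * cos φ - v₂ * sin θ * sin φ - v₃ * cos θ) ^ 2 =
      sin θ * (2 * π * (v₀ - v₃ * cos θ) /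
        √((v₀ - v₃ * cos θ) ^ 2 - (v₁ * sin θ) ^ 2 - (v₂ * sin θ) ^ 2) ^ 3) := by
    rw [← integral_inv_sq_sub_cos_sub_sin (hA θ) (hQ θ), ← intervalIntegral.integral_const_mul]
    refine intervalIntegral.integral_congr fun φ _ ↦ ?_
    simp only [mul_one_div]
    congr 2
    ring
  simp only [hinner]
  set m := v₀ ^ 2 - v₁ ^ 2 - v₂ ^ 2 - v₃ ^ 2 with hm_def
  have hderiv (θ : ℝ) : HasDerivAt (fun θ ↦ 2 * π / m * ((v₃ - v₀ * cos θ) /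
      √((v₀ - v₃ * cos θ) ^ 2 - (v₁ * sin θ) ^ 2 - (v₂ * sin θ) ^ 2)))
      (sin θ * (2 * π * (v₀ - v₃ * cos θ) /
        √((v₀ - v₃ * cos θ) ^ 2 - (v₁ * sin θ) ^ 2 - (v₂ * sin θ) ^ 2) ^ 3)) θ := by
    have hs := hasDerivAt_sin θ
    have hc := hasDerivAt_cos θ
    have hnum := (hc.const_mul v₀).const_sub v₃
    have hrad := (((((hc.const_mul v₃).const_sub v₀).pow 2).sub ((hs.const_mul v₁).pow 2)).sub
      ((hs.const_mul v₂).pow 2)).sqrt (hQ θ).ne'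
    have hS := sqrt_pos.2 (hQ θ)
    have hS2 := sq_sqrt (hQ θ).le
    refine ((hnum.div hrad hS.ne').const_mul (2 * π / m)).congr_deriv ?_
    simp only [Pi.sub_apply, Pi.pow_apply]
    generalize √((v₀ - v₃ * cos θ) ^ 2 - (v₁ * sin θ) ^ 2 - (v₂ * sin θ) ^ 2) = S at *
    have hcs := sin_sq_add_cos_sq θ
    field_simp
    rw [hm_def]
    simp only [Nat.cast_ofNat, Nat.add_one_sub_one, pow_one]
    linear_combination 2 * sin θ * v₀ * hS2 - 2 * v₀ * sin θ * (v₁ ^ 2 + v₂ ^ 2) * hcs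
  rw [intervalIntegral.integral_eq_sub_of_hasDerivAt (fun θ _ ↦ hderiv θ)
    (Continuous.intervalIntegrable (by
      refine continuous_sin.mul (Continuous.div (by fun_prop) (by fun_prop) fun θ ↦
        (pow_pos (sqrt_pos.2 (hQ θ)) 3).ne')) _ _)]
  have h1 : 0 < v₀ - v₃ := by linarith
  have h2 : 0 < v₀ + v₃ := by linarith
  simp only [sin_pi, cos_pi, sin_zero, cos_zero, mul_zero, mul_one, mul_neg, sub_neg_eq_add, ne_eq,
    OfNat.ofNat_ne_zero, not_false_eq_true, zero_pow, sub_zero, sqrt_sq h1.le, sqrt_sq h2.le]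
  field_simp
  ring
end
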